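/- arXiv:1307.5411 — 2 statements merged into one kernel-verified Lean document; each statement's English description precedes it below -/
import Mathlib

section
/- Let n be a positive integer and let G be a graph cospectral with the friendship graph F_n. If H is a finite simple graph having at least two adjacency eigenvalues strictly less than −1 (counted with multiplicity), then G has no induced subgraph isomorphic to H. -/
open Polynomial

/-- The adjacency matrix of a simple graph, with entries in `R`. -/
noncomputable def adjMat (R : Type*) [Zero R] [One R] {V : Type*} [Fintype V]
    (G : SimpleGraph V) : Matrix V V R :=
  letI := Classical.decRel G.Adj
  G.adjMatrix R

/-- The friendship graph `F n`: `n` triangles glued at the common vertex `none`. -/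
def friendshipGraph (n : ℕ) : SimpleGraph (Option (Fin n × Bool)) :=
  SimpleGraph.fromRel (fun u v =>
    u = none ∨ ∃ i : Fin n, u = some (i, true) ∧ v = some (i, false))

/-- Two finite graphs are cospectral if their real adjacency matrices have the same
characteristic polynomial. -/
def Cospectral {V W : Type*} [Fintype V] [Fintype W] [DecidableEq V] [DecidableEq W]
    (G : SimpleGraph V) (H : SimpleGraph W) : Prop :=
  (adjMat ℝ G).charpoly = (adjMat ℝ H).charpoly

open Matrix

namespace Matrix.IsHermitian

variable {ι : Type*} [Fintype ι] [DecidableEq ι] {M : Matrix ι ι ℝ}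

theorem dotProduct_eigenvectorUnitary_mulVec (hM : M.IsHermitian) (z : ι → ℝ) :
    ((hM.eigenvectorUnitary : Matrix ι ι ℝ) *ᵥ z) ⬝ᵥ
      ((hM.eigenvectorUnitary : Matrix ι ι ℝ) *ᵥ z) = ∑ k, z k ^ 2 := by
  have h : (hM.eigenvectorUnitary : Matrix ι ι ℝ)ᵀ * hM.eigenvectorUnitary = 1 :=
    Unitary.coe_star_mul_self hM.eigenvectorUnitary
  rw [Matrix.dotProduct_mulVec, ← Matrix.mulVec_transpose, Matrix.mulVec_mulVec, h,
    Matrix.one_mulVec]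
  simp [dotProduct, sq]

theorem dotProduct_mulVec_eigenvectorUnitary_mulVec (hM : M.IsHermitian) (z : ι → ℝ) :
    ((hM.eigenvectorUnitary : Matrix ι ι ℝ) *ᵥ z) ⬝ᵥ
      M *ᵥ ((hM.eigenvectorUnitary : Matrix ι ι ℝ) *ᵥ z) =
        ∑ k, hM.eigenvalues k * z k ^ 2 := by
  have h : (hM.eigenvectorUnitary : Matrix ι ι ℝ)ᵀ * M * hM.eigenvectorUnitary =
      diagonal hM.eigenvalues := by
    simpa [Unitary.conjStarAlgAut_apply, Function.comp_def, Matrix.star_eq_conjTranspose]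
      using hM.conjStarAlgAut_star_eigenvectorUnitary
  rw [dotProduct_comm, Matrix.dotProduct_mulVec, ← Matrix.mulVec_transpose, Matrix.mulVec_mulVec,
    Matrix.mulVec_mulVec, h]
  simp only [dotProduct, Matrix.mulVec_diagonal]
  exact Finset.sum_congr rfl fun k _ => by ring

/-- If two eigenvalues are less than `c`, then every hyperplane contains a vector on which the
Rayleigh quotient is less than `c`. -/
theorem exists_dotProduct_mulVec_lt (hM : M.IsHermitian) {c : ℝ} {i j : ι} (hij : i ≠ j)
    (hi : hM.eigenvalues i < c) (hj : hM.eigenvalues j < c) (f : (ι → ℝ) →ₗ[ℝ] ℝ) :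
    ∃ w, f w = 0 ∧ w ⬝ᵥ M *ᵥ w < c * (w ⬝ᵥ w) := by
  set g : (ι → ℝ) →ₗ[ℝ] ℝ := f ∘ₗ Matrix.mulVecLin (hM.eigenvectorUnitary : Matrix ι ι ℝ)
  obtain ⟨a, b, hab, hg⟩ : ∃ a b : ℝ, (a ≠ 0 ∨ b ≠ 0) ∧
      a * g (Pi.single i 1) + b * g (Pi.single j 1) = 0 := by
    by_cases h : g (Pi.single j 1) = 0
    · exact ⟨0, 1, by simp, by simp [h]⟩
    · exact ⟨g (Pi.single j 1), -g (Pi.single i 1), .inl h, by ring⟩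
  set z : ι → ℝ := a • Pi.single i 1 + b • Pi.single j 1 with hz
  have hzi : z i = a := by simp [hz, hij]
  have hzj : z j = b := by simp [hz, hij.symm]
  have hzk : ∀ k, k ≠ i → k ≠ j → z k = 0 := fun k h₁ h₂ => by simp [hz, h₁, h₂]
  refine ⟨(hM.eigenvectorUnitary : Matrix ι ι ℝ) *ᵥ z, ?_, ?_⟩
  · change g z = 0
    simpa [hz] using hg
  · rw [dotProduct_eigenvectorUnitary_mulVec, dotProduct_mulVec_eigenvectorUnitary_mulVec,
      Finset.mul_sum]
    refine Finset.sum_lt_sum (fun k _ => ?_) ?_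
    · by_cases h₁ : k = i
      · subst h₁; gcongr
      by_cases h₂ : k = j
      · subst h₂; gcongr
      simp [hzk k h₁ h₂]
    · rcases hab with h | h
      · exact ⟨i, Finset.mem_univ _, mul_lt_mul_of_pos_right hi (by rw [hzi]; positivity)⟩
      · exact ⟨j, Finset.mem_univ _, mul_lt_mul_of_pos_right hj (by rw [hzj]; positivity)⟩

/-- If at most one eigenvalue is less than `c`, then the Rayleigh quotient is at least `c` on some
hyperplane. -/
theorem exists_forall_le_dotProduct_mulVec (hM : M.IsHermitian) {c : ℝ}
    (h : ∀ i j, hM.eigenvalues i < c → hM.eigenvalues j < c → i = j) :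
    ∃ f : (ι → ℝ) →ₗ[ℝ] ℝ, ∀ w, f w = 0 → c * (w ⬝ᵥ w) ≤ w ⬝ᵥ M *ᵥ w := by
  have hU : (hM.eigenvectorUnitary : Matrix ι ι ℝ) *
      star (hM.eigenvectorUnitary : Matrix ι ι ℝ) = 1 :=
    Unitary.coe_mul_star_self hM.eigenvectorUnitary
  have key (w : ι → ℝ) (hw : ∀ k, hM.eigenvalues k < c →
      (star (hM.eigenvectorUnitary : Matrix ι ι ℝ) *ᵥ w) k = 0) :
      c * (w ⬝ᵥ w) ≤ w ⬝ᵥ M *ᵥ w := by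
    obtain ⟨z, hz⟩ : ∃ z, star (hM.eigenvectorUnitary : Matrix ι ι ℝ) *ᵥ w = z := ⟨_, rfl⟩
    have hwz : w = (hM.eigenvectorUnitary : Matrix ι ι ℝ) *ᵥ z := by
      rw [← hz, Matrix.mulVec_mulVec, hU, Matrix.one_mulVec]
    rw [hz] at hw
    rw [hwz, dotProduct_eigenvectorUnitary_mulVec, dotProduct_mulVec_eigenvectorUnitary_mulVec,
      Finset.mul_sum]
    refine Finset.sum_le_sum fun k _ => ?_
    rcases lt_or_ge (hM.eigenvalues k) c with hk | hk
    · simp [hw k hk]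
    · gcongr
  by_cases hex : ∃ i, hM.eigenvalues i < c
  · obtain ⟨i, hi⟩ := hex
    refine ⟨LinearMap.proj i ∘ₗ
      Matrix.mulVecLin (star (hM.eigenvectorUnitary : Matrix ι ι ℝ)), fun w hw => key w ?_⟩
    intro k hk
    rw [h k i hk hi]
    exact hw
  · push Not at hex
    exact ⟨0, fun w _ => key w fun k hk => absurd hk (hex k).not_gt⟩

/-- The number of eigenvalues below a threshold depends only on the characteristic polynomial. -/
theorem card_eigenvalues_lt_eq_of_charpoly_eq {κ : Type*} [Fintype κ] [DecidableEq κ]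
    {N : Matrix κ κ ℝ} (hM : M.IsHermitian) (hN : N.IsHermitian) (h : M.charpoly = N.charpoly)
    (c : ℝ) :
    (Finset.univ.filter fun i => hM.eigenvalues i < c).card =
      (Finset.univ.filter fun i => hN.eigenvalues i < c).card := by
  have hroots : Finset.univ.val.map hM.eigenvalues = Finset.univ.val.map hN.eigenvalues := by
    simpa [Function.comp_def] using hM.roots_charpoly_eq_eigenvalues.symm.trans
      ((congrArg Polynomial.roots h).trans hN.roots_charpoly_eq_eigenvalues)
  have hcount := congrArg (Multiset.countP (· < c)) hroots
  simpa only [Multiset.countP_map, ← Finset.filter_val, Finset.card_val] using hcount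

end Matrix.IsHermitian

theorem isHermitian_adjMat {V : Type*} [Fintype V] (G : SimpleGraph V) :
    (adjMat ℝ G).IsHermitian := by
  classical
  ext i j
  simp [adjMat, SimpleGraph.adjMatrix_apply, G.adj_comm]

open Classical in
theorem adjMat_apply {V : Type*} [Fintype V] (G : SimpleGraph V) (u v : V) :
    adjMat ℝ G u v = if G.Adj u v then 1 else 0 := by
  simp [adjMat, SimpleGraph.adjMatrix_apply]

theorem adjMat_friendshipGraph_some {n : ℕ} (i j : Fin n) (a b : Bool) :
    adjMat ℝ (friendshipGraph n) (some (i, a)) (some (j, b)) =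
      if i = j ∧ b = !a then 1 else 0 := by
  rw [adjMat_apply]
  congr 1
  cases a <;> cases b <;> simp [friendshipGraph, eq_comm]

theorem neg_dotProduct_self_le_adjMat_friendshipGraph {n : ℕ} (w : Option (Fin n × Bool) → ℝ)
    (hw : w none = 0) :
    -1 * (w ⬝ᵥ w) ≤ w ⬝ᵥ adjMat ℝ (friendshipGraph n) *ᵥ w := by
  simp only [dotProduct, Matrix.mulVec, Fintype.sum_option, hw, Fintype.sum_prod_type,
    Fintype.sum_bool, adjMat_friendshipGraph_some]
  simp only [zero_mul, mul_zero, zero_add, Bool.not_true, Bool.not_false, and_true, and_false,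
    reduceCtorEq, if_false, ite_mul, one_mul, add_zero, Finset.sum_ite_eq, Finset.mem_univ, if_true,
    Finset.sum_const_zero, Finset.mul_sum]
  refine Finset.sum_le_sum fun i _ => ?_
  nlinarith [sq_nonneg (w (some (i, true)) + w (some (i, false)))]

theorem extend_zero_dotProduct {ι κ : Type*} [Fintype ι] [Fintype κ] {e : ι → κ}
    (he : Function.Injective e) (w : ι → ℝ) (x : κ → ℝ) :
    Function.extend e w 0 ⬝ᵥ x = w ⬝ᵥ (x ∘ e) := by
  refine (Fintype.sum_of_injective e he _ _ (fun k hk => ?_) fun i => ?_).symm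
  · rw [Function.extend_apply' w (0 : κ → ℝ) k hk, Pi.zero_apply, zero_mul]
  · simp [he.extend_apply]

/-- Extension by zero along an induced embedding preserves the adjacency quadratic form. -/
theorem extend_zero_dotProduct_adjMat_mulVec {V W : Type*} [Fintype V] [Fintype W]
    {G : SimpleGraph V} {H : SimpleGraph W} (e : H ↪g G) (w : W → ℝ) :
    Function.extend e w 0 ⬝ᵥ adjMat ℝ G *ᵥ Function.extend e w 0 = w ⬝ᵥ adjMat ℝ H *ᵥ w := by
  rw [extend_zero_dotProduct e.injective]
  congr 1
  ext i
  rw [Function.comp_apply, Matrix.mulVec, dotProduct_comm, extend_zero_dotProduct e.injective,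
    dotProduct_comm, Matrix.mulVec]
  congr 1
  ext j
  classical
  rw [Function.comp_apply, adjMat_apply, adjMat_apply]
  exact if_congr e.map_adj_iff rfl rfl

theorem eigenvalues_adjMat_friendshipGraph_lt_neg_one {n : ℕ}
    (hF : (adjMat ℝ (friendshipGraph n)).IsHermitian) {i j : Option (Fin n × Bool)}
    (hi : hF.eigenvalues i < -1) (hj : hF.eigenvalues j < -1) : i = j := by
  by_contra hij
  obtain ⟨w, hw, hlt⟩ := hF.exists_dotProduct_mulVec_lt hij hi hj (LinearMap.proj none)
  exact hlt.not_ge (neg_dotProduct_self_le_adjMat_friendshipGraph w hw)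

/-- if `G` is cospectral with the friendship graph `F n` and `H` is a graph
having at least two adjacency eigenvalues strictly less than `-1` (counted with
multiplicity), then `G` has no induced subgraph isomorphic to `H`. -/
theorem no_induced_subgraph_of_two_eigenvalues_lt_neg_one
    {V W : Type*} [Fintype V] [Fintype W] [DecidableEq V] [DecidableEq W]
    (n : ℕ) (hn : 0 < n) (G : SimpleGraph V)
    (hG : Cospectral G (friendshipGraph n))
    (H : SimpleGraph W) (hH : (adjMat ℝ H).IsHermitian)
    (hl : ∃ i j : W, i ≠ j ∧ hH.eigenvalues i < -1 ∧ hH.eigenvalues j < -1) :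
    IsEmpty (H ↪g G) := by
  refine ⟨fun e => ?_⟩
  have hA := isHermitian_adjMat G
  have hF := isHermitian_adjMat (friendshipGraph n)
  have hA1 : ∀ i j, hA.eigenvalues i < -1 → hA.eigenvalues j < -1 → i = j := by
    have hcard : (Finset.univ.filter fun i => hA.eigenvalues i < -1).card ≤ 1 := by
      rw [hA.card_eigenvalues_lt_eq_of_charpoly_eq hF hG, Finset.card_le_one]
      intro i hi j hj
      exact eigenvalues_adjMat_friendshipGraph_lt_neg_one hF (Finset.mem_filter.mp hi).2
        (Finset.mem_filter.mp hj).2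
    intro i j hi hj
    exact Finset.card_le_one.mp hcard i (by simpa using hi) j (by simpa using hj)
  obtain ⟨f, hf⟩ := hA.exists_forall_le_dotProduct_mulVec hA1
  obtain ⟨i, j, hij, hi, hj⟩ := hl
  obtain ⟨w, hw, hlt⟩ := hH.exists_dotProduct_mulVec_lt hij hi hj
    (f ∘ₗ Function.ExtendByZero.linearMap ℝ e)
  have hle := hf (Function.extend e w 0) hw
  rw [extend_zero_dotProduct_adjMat_mulVec, extend_zero_dotProduct e.injective,
    Function.extend_comp e.injective] at hle
  exact hlt.not_ge hle
end

section
/- Let n be a positive integer and let G be a graph cospectral with the friendship graph F_n. If G contains three mutually adjacent vertices x, y, z (a triangle) such that x and y both have degree 2 in G, then G is isomorphic to F_n. -/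
open Polynomial

open Matrix Finset

/-- A polynomial vanishing at every root of the characteristic polynomial of a real symmetric
matrix annihilates that matrix; here for the polynomial `(X ^ 2 - 1) * (X ^ 2 - X - c)`. -/
lemma mulVec_quartic_eq {V : Type*} [Fintype V] [DecidableEq V] {A : Matrix V V ℝ}
    (hA : A.IsHermitian) {c : ℝ}
    (hroot : ∀ μ, A.charpoly.IsRoot μ → (μ ^ 2 - 1) * (μ ^ 2 - μ - c) = 0) (f : V → ℝ) :
    A *ᵥ A *ᵥ (A *ᵥ A *ᵥ f - f) = A *ᵥ (A *ᵥ A *ᵥ f - f) + c • (A *ᵥ A *ᵥ f - f) := by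
  let P : Matrix V V ℝ := A * A * (A * A - 1) - A * (A * A - 1) - c • (A * A - 1)
  have hP : Matrix.toEuclideanLin P = 0 := by
    refine hA.eigenvectorBasis.toBasis.ext fun j => ?_
    have hj := hA.mulVec_eigenvectorBasis j
    have h0 := hroot _ (Matrix.mem_spectrum_iff_isRoot_charpoly.1
      (hA.eigenvalues_mem_spectrum_real j))
    generalize hA.eigenvalues j = μ at *
    ext i
    simp only [OrthonormalBasis.coe_toBasis, Matrix.toLpLin_apply, LinearMap.zero_apply, P,
      sub_mulVec, ← mulVec_mulVec, smul_mulVec, one_mulVec, mulVec_sub, mulVec_smul, hj]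
    simp only [PiLp.zero_apply, Pi.sub_apply, Pi.smul_apply, smul_eq_mul]
    linear_combination (hA.eigenvectorBasis j i) * h0
  have hP0 : P = 0 := by simpa using hP
  have hf : P *ᵥ f = 0 := by rw [hP0, zero_mulVec]
  simp only [P, sub_mulVec, ← mulVec_mulVec, smul_mulVec, one_mulVec] at hf
  rw [sub_sub, sub_eq_zero] at hf
  exact hf

lemma adjMat_mulVec_apply {V : Type*} [Fintype V] (G : SimpleGraph V) [DecidableRel G.Adj]
    (f : V → ℝ) (v : V) : (adjMat ℝ G *ᵥ f) v = ∑ w ∈ G.neighborFinset v, f w := by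
  classical
  rw [adjMat, SimpleGraph.adjMatrix_mulVec_apply]
  congr!

@[simp] lemma friendshipGraph_adj_none_some {n : ℕ} (p : Fin n × Bool) :
    (friendshipGraph n).Adj none (some p) := by
  simp [friendshipGraph]

@[simp] lemma friendshipGraph_adj_some_none {n : ℕ} (p : Fin n × Bool) :
    (friendshipGraph n).Adj (some p) none := (friendshipGraph_adj_none_some p).symm

@[simp] lemma friendshipGraph_adj_some_some {n : ℕ} (p q : Fin n × Bool) :
    (friendshipGraph n).Adj (some p) (some q) ↔ q = (p.1, !p.2) := by
  obtain ⟨i, a⟩ := p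
  obtain ⟨j, b⟩ := q
  cases a <;> cases b <;> simp [friendshipGraph, Prod.ext_iff, eq_comm]

lemma adjMat_friendshipGraph_mulVec_none {n : ℕ} (f : Option (Fin n × Bool) → ℝ) :
    (adjMat ℝ (friendshipGraph n) *ᵥ f) none =
      ∑ i, (f (some (i, true)) + f (some (i, false))) := by
  classical
  simp [adjMat, mulVec, dotProduct, Fintype.sum_option, Fintype.sum_prod_type,
    SimpleGraph.adjMatrix_apply]

lemma adjMat_friendshipGraph_mulVec_some {n : ℕ} (f : Option (Fin n × Bool) → ℝ)
    (p : Fin n × Bool) :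
    (adjMat ℝ (friendshipGraph n) *ᵥ f) (some p) = f none + f (some (p.1, !p.2)) := by
  classical
  simp [adjMat, mulVec, dotProduct, Fintype.sum_option, SimpleGraph.adjMatrix_apply]

/-- The eigenvalues of the friendship graph are among `±1` and the roots of `X ^ 2 - X - 2 n`. -/
lemma quartic_eq_zero_of_isRoot_charpoly_friendshipGraph {n : ℕ} {μ : ℝ}
    (h : (adjMat ℝ (friendshipGraph n)).charpoly.IsRoot μ) :
    (μ ^ 2 - 1) * (μ ^ 2 - μ - 2 * n) = 0 := by
  rw [IsRoot.def, Matrix.eval_charpoly] at h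
  obtain ⟨f, hf0, hf⟩ := Matrix.exists_mulVec_eq_zero_iff.2 h
  have hf' : adjMat ℝ (friendshipGraph n) *ᵥ f = μ • f := by
    rw [sub_mulVec, sub_eq_zero] at hf
    rw [← hf]
    ext u
    simp [Matrix.scalar_apply, mulVec_diagonal]
  have hc := congrFun hf' none
  rw [adjMat_friendshipGraph_mulVec_none, Pi.smul_apply, smul_eq_mul] at hc
  have hp (p : Fin n × Bool) : f none + f (some (p.1, !p.2)) = μ * f (some p) := by
    rw [← adjMat_friendshipGraph_mulVec_some, hf', Pi.smul_apply, smul_eq_mul]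
  have hcenter : (μ ^ 2 - μ - 2 * n) * f none = 0 := by
    have hsum : (μ - 1) * ∑ i, (f (some (i, true)) + f (some (i, false))) =
        ∑ _i : Fin n, 2 * f none := by
      rw [mul_sum]
      refine sum_congr rfl fun i _ => ?_
      have h1 := hp (i, true)
      have h2 := hp (i, false)
      simp only [Bool.not_true, Bool.not_false] at h1 h2
      linear_combination -h1 - h2
    rw [hc] at hsum
    simp only [sum_const, card_univ, Fintype.card_fin, nsmul_eq_mul] at hsum
    linear_combination hsum
  obtain ⟨u, hu⟩ := Function.ne_iff.1 hf0
  refine (mul_eq_zero.1 ?_).resolve_right hu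
  rcases u with _ | p
  · linear_combination (μ ^ 2 - 1) * hcenter
  · have h1 := hp p
    have h2 := hp (p.1, !p.2)
    simp only [Bool.not_not, Prod.mk.eta] at h2
    linear_combination (μ + 1) * hcenter -
      (μ ^ 2 - μ - 2 * n) * (μ * h1 + h2)

/-- A fixed-point-free involution on `2 n` points is the swap on `Fin n × Bool`, up to
relabelling. -/
lemma Function.Involutive.exists_equiv_prod_bool {W : Type*} [Fintype W] {σ : W → W}
    (hσ : Function.Involutive σ) (hfix : ∀ w, σ w ≠ w) {n : ℕ} (hcard : Fintype.card W = 2 * n) :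
    ∃ e : Fin n × Bool ≃ W, ∀ p, σ (e p) = e (p.1, !p.2) := by
  classical
  let r := Fintype.equivFin W
  let T := {w : W // r w < r (σ w)}
  let φ : T × Bool → W := fun p => if p.2 then p.1 else σ p.1
  have hφ : Function.Bijective φ := by
    constructor
    · rintro ⟨⟨a, ha⟩, i⟩ ⟨⟨b, hb⟩, j⟩ hab
      cases i <;> cases j <;> simp only [φ, Bool.false_eq_true, if_true, if_false] at hab
      · simp [hσ.injective hab]
      · subst hab
        rw [hσ] at hb
        exact absurd ha hb.asymm
      · subst hab
        rw [hσ] at ha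
        exact absurd hb ha.asymm
      · simp [hab]
    · intro w
      rcases lt_or_gt_of_ne (r.injective.ne (hfix w)) with h | h
      · exact ⟨(⟨σ w, by rwa [hσ]⟩, false), by simp [φ, hσ w]⟩
      · exact ⟨(⟨w, h⟩, true), by simp [φ]⟩
  have hT : Fintype.card T = n := by
    have := Fintype.card_of_bijective hφ
    rw [Fintype.card_prod, Fintype.card_bool] at this
    lia
  refine ⟨(((Fintype.equivFinOfCardEq hT).symm).prodCongr (Equiv.refl Bool)).trans
    (Equiv.ofBijective φ hφ), ?_⟩
  rintro ⟨i, _ | _⟩ <;> simp [φ, hσ _]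

/-- A graph with a dominating vertex `z` in which every other vertex has exactly one neighbour
besides `z` is a friendship graph. -/
lemma nonempty_iso_friendshipGraph {V : Type*} [Fintype V] {G : SimpleGraph V} {n : ℕ}
    (hcard : Fintype.card V = 2 * n + 1) {z : V} (hz : ∀ u, u ≠ z → G.Adj z u)
    (hu : ∀ u, u ≠ z → ∃! w, G.Adj u w ∧ w ≠ z) : Nonempty (G ≃g friendshipGraph n) := by
  classical
  choose! s hs hs' using hu
  let σ : {u // u ≠ z} → {u // u ≠ z} := fun u => ⟨s u, (hs u u.2).2⟩
  have hadj (u w : {u // u ≠ z}) : G.Adj u w ↔ w = σ u := by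
    refine ⟨fun h => Subtype.ext (hs' u u.2 w ⟨h, w.2⟩), ?_⟩
    rintro rfl
    exact (hs u u.2).1
  have hσ : Function.Involutive σ := fun u =>
    ((hadj _ _).1 ((hadj _ _).2 rfl).symm).symm
  have hfix (w) : σ w ≠ w := fun h => G.irrefl ((hadj w w).2 h.symm)
  obtain ⟨e, he⟩ := hσ.exists_equiv_prod_bool hfix (n := n) (by
    rw [Fintype.card_subtype_compl, Fintype.card_subtype_eq, hcard, Nat.add_sub_cancel])
  let E : Option (Fin n × Bool) ≃ V := (Equiv.optionCongr e).trans (Equiv.optionSubtypeNe z)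
  have hE0 : E none = z := by simp [E]
  have hE (p) : E (some p) = e p := by simp [E]
  refine ⟨(RelIso.symm ⟨E, ?_⟩)⟩
  rintro (_ | p) (_ | q)
  · simp
  · simpa [hE0, hE] using hz _ (e q).2
  · simpa [hE0, hE] using (hz _ (e p).2).symm
  · rw [hE, hE, hadj, he, e.injective.eq_iff, friendshipGraph_adj_some_some]

/-- if `G` is cospectral with the friendship graph `F n` and contains a
triangle `x, y, z` in which `x` and `y` both have degree 2, then `G ≅ F n`. -/
theorem cospectral_triangle_two_degree_two_iso
    {V : Type*} [Fintype V] [DecidableEq V]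
    (n : ℕ) (hn : 0 < n) (G : SimpleGraph V) [DecidableRel G.Adj]
    (hG : Cospectral G (friendshipGraph n))
    (x y z : V) (hxy : G.Adj x y) (hyz : G.Adj y z) (hxz : G.Adj x z)
    (hdx : G.degree x = 2) (hdy : G.degree y = 2) :
    Nonempty (G ≃g friendshipGraph n) := by
  have hpoly : (adjMat ℝ G).charpoly = (adjMat ℝ (friendshipGraph n)).charpoly := hG
  have hcard : Fintype.card V = 2 * n + 1 := by
    have := congrArg natDegree hpoly
    simp only [charpoly_natDegree_eq_dim, Fintype.card_option, Fintype.card_prod,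
      Fintype.card_fin, Fintype.card_bool] at this
    lia
  have hA : (adjMat ℝ G).IsHermitian := by
    rw [IsHermitian, conjTranspose_eq_transpose_of_trivial, adjMat,
      SimpleGraph.transpose_adjMatrix]
  have key := mulVec_quartic_eq hA (c := 2 * n)
    (fun μ hμ => quartic_eq_zero_of_isRoot_charpoly_friendshipGraph (hpoly ▸ hμ)) (Pi.single x 1)
  have hNx : G.neighborFinset x = {y, z} := by
    refine (eq_of_subset_of_card_le (fun w => ?_) ?_).symm
    · simp only [mem_insert, mem_singleton, SimpleGraph.mem_neighborFinset]
      rintro (rfl | rfl) <;> assumption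
    · rw [SimpleGraph.card_neighborFinset_eq_degree, hdx, card_pair hyz.ne]
  have hNy : G.neighborFinset y = {x, z} := by
    refine (eq_of_subset_of_card_le (fun w => ?_) ?_).symm
    · simp only [mem_insert, mem_singleton, SimpleGraph.mem_neighborFinset]
      rintro (rfl | rfl)
      exacts [hxy.symm, hyz]
    · rw [SimpleGraph.card_neighborFinset_eq_degree, hdy, card_pair hxz.ne]
  have hx (w) : G.Adj w x ↔ w = y ∨ w = z := by
    rw [G.adj_comm, ← SimpleGraph.mem_neighborFinset, hNx, mem_insert, mem_singleton]
  have hy (w) : G.Adj w y ↔ w = x ∨ w = z := by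
    rw [G.adj_comm, ← SimpleGraph.mem_neighborFinset, hNy, mem_insert, mem_singleton]
  -- The closed neighbourhood of `z`, as a vector, is `(A ^ 2 - 1) e_x`.
  have hq : adjMat ℝ G *ᵥ adjMat ℝ G *ᵥ Pi.single x 1 - Pi.single x 1 =
      fun u => if u = z ∨ G.Adj z u then 1 else 0 := by
    have h1 : adjMat ℝ G *ᵥ Pi.single x 1 = Pi.single y 1 + Pi.single z 1 := by
      ext u
      simp only [adjMat_mulVec_apply, Pi.add_apply, Pi.single_apply, sum_ite_eq',
        SimpleGraph.mem_neighborFinset, hx]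
      have := hyz.ne
      grind
    ext u
    rw [h1, mulVec_add, Pi.sub_apply, Pi.add_apply]
    simp only [adjMat_mulVec_apply, Pi.single_apply, sum_ite_eq',
      SimpleGraph.mem_neighborFinset, hy]
    have := hxz.ne
    have := hxz.symm
    have := G.adj_comm u z
    have := G.irrefl (v := z)
    grind
  rw [hq] at key
  have hdz : G.degree z = 2 * n := by
    have := congrFun key x
    simp only [Pi.add_apply, Pi.smul_apply, adjMat_mulVec_apply, hNx, hNy, sum_pair hyz.ne,
      sum_pair hxz.ne, hxz.symm, hyz.symm, or_true, true_or, if_true, smul_eq_mul] at this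
    rw [sum_congr rfl (g := fun _ => (1 : ℝ)) (by simp +contextual)] at this
    simp only [sum_const, SimpleGraph.card_neighborFinset_eq_degree, nsmul_eq_mul] at this
    have h' : (G.degree z : ℝ) = 2 * n := by linarith
    exact_mod_cast h'
  have hz (u) (hu : u ≠ z) : G.Adj z u := by
    have : G.neighborFinset z = univ.erase z := by
      refine eq_of_subset_of_card_le (fun w => ?_) ?_
      · simpa using fun h => h.ne'
      · rw [card_erase_of_mem (mem_univ _), card_univ, hcard,
          SimpleGraph.card_neighborFinset_eq_degree, hdz, Nat.add_sub_cancel]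
    rw [← SimpleGraph.mem_neighborFinset, this]
    simpa using hu
  -- The vector of degrees `d` satisfies `A d = d + 2 n`.
  have hdeg (u) : ∑ w ∈ G.neighborFinset u, G.degree w = G.degree u + 2 * n := by
    have hone : (fun u => if u = z ∨ G.Adj z u then (1 : ℝ) else 0) = fun _ => 1 := by
      ext u
      rw [if_pos (or_iff_not_imp_left.2 (hz u))]
    have := congrFun key u
    simp only [hone, Pi.add_apply, Pi.smul_apply, adjMat_mulVec_apply, sum_const, smul_eq_mul,
      SimpleGraph.card_neighborFinset_eq_degree, nsmul_eq_mul, mul_one] at this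
    exact_mod_cast this
  refine nonempty_iso_friendshipGraph hcard hz fun u hu => ?_
  have hzu : z ∈ G.neighborFinset u := by simpa using (hz u hu).symm
  have hsum : ∑ w ∈ (G.neighborFinset u).erase z, (G.degree w - 1) = 1 := by
    have h1 := hdeg u
    rw [← add_sum_erase _ _ hzu, hdz] at h1
    have h2 : ∑ w ∈ (G.neighborFinset u).erase z, (G.degree w - 1 + 1) =
        ∑ w ∈ (G.neighborFinset u).erase z, G.degree w :=
      sum_congr rfl fun w hw => Nat.sub_add_cancel
        ((G.degree_pos_iff_exists_adj w).2 ⟨z, (hz w (ne_of_mem_erase hw)).symm⟩)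
    have h3 := card_erase_add_one hzu
    rw [SimpleGraph.card_neighborFinset_eq_degree] at h3
    rw [sum_add_distrib, sum_const, smul_eq_mul, mul_one] at h2
    lia
  have hcard_erase : #((G.neighborFinset u).erase z) = 1 := by
    refine le_antisymm ?_ ?_
    · rw [← hsum, card_eq_sum_ones]
      refine sum_le_sum fun w hw => ?_
      obtain ⟨hwz, hw⟩ := mem_erase.1 hw
      have : #{u, z} ≤ #(G.neighborFinset w) := card_le_card fun v => by
        simp only [mem_insert, mem_singleton, SimpleGraph.mem_neighborFinset] at hw ⊢
        rintro (rfl | rfl)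
        exacts [hw.symm, (hz w hwz).symm]
      rw [card_pair hu, SimpleGraph.card_neighborFinset_eq_degree] at this
      lia
    · refine card_pos.2 (nonempty_of_sum_ne_zero (f := fun w => G.degree w - 1) ?_)
      rw [hsum]
      exact one_ne_zero
  obtain ⟨w, hw⟩ := card_eq_one.1 hcard_erase
  have hmem (v) : G.Adj u v ∧ v ≠ z ↔ v = w := by
    rw [← mem_singleton, ← hw, mem_erase, SimpleGraph.mem_neighborFinset, and_comm]
  exact ⟨w, (hmem w).2 rfl, fun v hv => (hmem v).1 hv⟩
end
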